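/- arXiv:1106.2295 — 2 statements merged into one kernel-verified Lean document; each statement's English description precedes it below -/
import Mathlib

section
/- Totally nonnegative matrices are preserved under a Neville elimination move: let A be a totally nonnegative m×n real matrix with a_{st} ≠ 0, a_{ij} = 0 whenever i ≥ s and j < t, a_{s+1,t} ≠ 0, and a_{s+w,t} = 0 for all w > 1. Let B be obtained from A by subtracting (a_{s+1,t}/a_{st}) times row s from row s+1. Then B is totally nonnegative. -/
open Matrix

/-- A real matrix is totally nonnegative if every minor is nonnegative. -/
def TotNonneg {m n : ℕ} (A : Matrix (Fin m) (Fin n) ℝ) : Prop :=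
  ∀ (s : ℕ) (f : Fin s → Fin m) (g : Fin s → Fin n),
    StrictMono f → StrictMono g → 0 ≤ (A.submatrix f g).det

/-- The class `M_{r,c}`. -/
def InM {F : Type} [Field F] {m n t : ℕ} (A : Matrix (Fin m) (Fin n) F)
    (r : Fin t → Fin m) (c : Fin t → Fin n) : Prop :=
  A.rank = t ∧
  (∀ (s : ℕ) (hs : s ≤ t),
    (A.submatrix (fun k => r (Fin.castLE hs k)) (fun k => c (Fin.castLE hs k))).det ≠ 0) ∧
  (∀ (s : ℕ) (hs : s ≤ t) (f : Fin s → Fin m) (g : Fin s → Fin n),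
    StrictMono f → StrictMono g →
    (¬ (∀ k, r (Fin.castLE hs k) ≤ f k) ∨ ¬ (∀ k, c (Fin.castLE hs k) ≤ g k)) →
    (A.submatrix f g).det = 0)

/-- The class `L_r`. -/
def InL {F : Type} [Field F] {m t : ℕ} (L : Matrix (Fin m) (Fin t) F)
    (r : Fin t → Fin m) : Prop :=
  ∀ j, L (r j) j ≠ 0 ∧ ∀ i, i < r j → L i j = 0

/-- The class `L_r^*`. -/
def InLstar {F : Type} [Field F] {m t : ℕ} (L : Matrix (Fin m) (Fin t) F)
    (r : Fin t → Fin m) : Prop :=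
  ∀ j, L (r j) j = 1 ∧ ∀ i, i < r j → L i j = 0

/-- The class `U_c`. -/
def InU {F : Type} [Field F] {t n : ℕ} (U : Matrix (Fin t) (Fin n) F)
    (c : Fin t → Fin n) : Prop :=
  ∀ i, U i (c i) ≠ 0 ∧ ∀ j, j < c i → U i j = 0

theorem submatrix_update_row {R k l m n : Type*} [DecidableEq k] (A : Matrix m n R)
    (f : k → m) (g : l → n) (i : k) (x : m) :
    A.submatrix (Function.update f i x) g = (A.submatrix f g).updateRow i (fun j => A x (g j)) := by
  ext a b
  rcases eq_or_ne a i with rfl | h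
  · simp
  · simp [Matrix.updateRow_ne h, Function.update_of_ne h]

theorem det_submatrix_eq_zero_of_not_injective {R k m n : Type*} [CommRing R] [Fintype k]
    [DecidableEq k] (A : Matrix m n R) {f : k → m} (g : k → n) {a b : k} (hab : a ≠ b)
    (h : f a = f b) : (A.submatrix f g).det = 0 :=
  Matrix.det_zero_of_row_eq hab (by ext; simp [h])

theorem StrictMono.update_of_lt {α β : Type*} [LinearOrder α] [Preorder β] {f : α → β}
    (hf : StrictMono f) {i : α} {x : β} (hl : ∀ a < i, f a < x) (hr : ∀ a, i < a → x < f a) :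
    StrictMono (Function.update f i x) := by
  intro a b hab
  rcases eq_or_ne a i with rfl | ha
  · simpa [Function.update_of_ne hab.ne'] using hr b hab
  · rcases eq_or_ne b i with rfl | hb
    · simpa [Function.update_of_ne ha] using hl a hab
    · simpa [Function.update_of_ne ha, Function.update_of_ne hb] using hf hab

/-- Cramer's rule, paired with a linear functional on row vectors. -/
theorem det_mul_linearMap_eq_sum {R k : Type*} [CommRing R] [Fintype k] [DecidableEq k]
    (M : Matrix k k R) (x : k → R) (ψ : (k → R) →ₗ[R] R) :
    M.det * ψ x = ∑ a, (M.updateRow a x).det * ψ (M a) := by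
  have h := congrArg ψ (Matrix.mulVec_cramer Mᵀ x)
  rw [Matrix.mulVec_eq_sum, map_sum, map_smul, Matrix.det_transpose] at h
  simpa [Matrix.cramer_transpose_apply, Matrix.row_def] using h.symm

/-- A three-term Plücker relation between minors of sizes `k + 1` and `k`. -/
theorem det_submatrix_mul_det_submatrix_update {R m n : Type*} [CommRing R] {k : ℕ}
    (A : Matrix m n R) (f : Fin (k + 1) → m) (g : Fin (k + 1) → n) (i : Fin k) (j : Fin (k + 1))
    (x : m) :
    (A.submatrix f g).det *
        (A.submatrix (Function.update (f ∘ i.castSucc.succAbove) i x) (g ∘ j.succAbove)).det =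
      (A.submatrix (Function.update f i.succ x) g).det *
          (A.submatrix (f ∘ i.castSucc.succAbove) (g ∘ j.succAbove)).det +
        (A.submatrix (Function.update f i.castSucc x) g).det *
          (A.submatrix (Function.update (f ∘ i.castSucc.succAbove) i (f i.castSucc))
            (g ∘ j.succAbove)).det := by
  set h := f ∘ i.castSucc.succAbove with hh
  have hi : h i = f i.succ := by simp [hh]
  let N := A.submatrix h (g ∘ j.succAbove)
  let ψ : (Fin (k + 1) → R) →ₗ[R] R :=
    (Matrix.detRowAlternating.toMultilinearMap.toLinearMap N i).comp
      (LinearMap.funLeft R R j.succAbove)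
  have hψ (y : m) : ψ (fun b => A y (g b)) =
      (A.submatrix (Function.update h i y) (g ∘ j.succAbove)).det := by
    rw [submatrix_update_row]
    rfl
  have key := det_mul_linearMap_eq_sum (A.submatrix f g) (fun b => A x (g b)) ψ
  have hrow (a : Fin (k + 1)) : ψ (A.submatrix f g a) =
      (A.submatrix (Function.update h i (f a)) (g ∘ j.succAbove)).det := hψ (f a)
  simp only [hψ, hrow, ← submatrix_update_row] at key
  rw [key, Fintype.sum_eq_add i.succ i.castSucc (Fin.castSucc_lt_succ).ne']
  · rw [← hi, Function.update_eq_self]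
  · rintro a ⟨ha₁, ha₂⟩
    obtain ⟨b, rfl⟩ := Fin.exists_succAbove_eq ha₂
    have hb : b ≠ i := by
      rintro rfl
      simp at ha₁
    rw [det_submatrix_eq_zero_of_not_injective A _ hb, mul_zero]
    simp [Function.update_of_ne hb, hh]

theorem det_submatrix_ratio_le_of_zero {m n k : ℕ} {A : Matrix (Fin m) (Fin n) ℝ}
    (hA : TotNonneg A) {s v : Fin m} {t : Fin n} (hsv : s < v)
    (hzero : ∀ (i : Fin m) (j : Fin n), s ≤ i → j < t → A i j = 0)
    (hbelow : ∀ i : Fin m, v < i → A i t = 0)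
    {f : Fin (k + 1) → Fin m} {g : Fin (k + 1) → Fin n} (hf : StrictMono f) (hg : StrictMono g)
    (hv : f 0 = v) :
    A v t * (A.submatrix (Function.update f 0 s) g).det ≤ A s t * (A.submatrix f g).det := by
  have hfs (a : Fin k) : v < f a.succ := hv ▸ hf a.succ_pos
  rcases lt_trichotomy (g 0) t with h | h | h
  · have hle (a : Fin (k + 1)) : v ≤ f a := hv ▸ hf.monotone (Fin.zero_le a)
    rw [Matrix.det_eq_zero_of_column_eq_zero 0, Matrix.det_eq_zero_of_column_eq_zero 0]
    · simp
    · exact fun a => hzero _ _ (hsv.le.trans (hle a)) h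
    · refine Fin.cases ?_ (fun a => ?_)
      · simpa using hzero s _ le_rfl h
      · simpa using hzero _ _ (hsv.trans (hfs a)).le h
  · refine le_of_eq ?_
    rw [Matrix.det_succ_column_zero, Matrix.det_succ_column_zero, Fin.sum_univ_succ,
      Fin.sum_univ_succ]
    have hz (a : Fin k) : A (f a.succ) t = 0 := hbelow _ (hfs a)
    have hcomp : Function.update f 0 s ∘ Fin.succ = f ∘ Fin.succ := by
      ext a
      simp
    simp [h, hz, hv, hcomp]
    ring
  · have hcf : StrictMono (Fin.cons s f : Fin (k + 2) → Fin m) := by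
      rw [Fin.strictMono_iff_lt_succ]
      refine Fin.cases ?_ (fun a => ?_)
      · simpa [hv] using hsv
      · simpa [← Fin.succ_castSucc] using hf a.castSucc_lt_succ
    have hcg : StrictMono (Fin.cons t g : Fin (k + 2) → Fin n) := by
      rw [Fin.strictMono_iff_lt_succ]
      refine Fin.cases ?_ (fun a => ?_)
      · simpa using h
      · simpa [← Fin.succ_castSucc] using hg a.castSucc_lt_succ
    have hdet := hA _ _ _ hcf hcg
    rw [Matrix.det_succ_column_zero, Fin.sum_univ_succ, Fin.sum_univ_succ] at hdet
    have hz (a : Fin k) : A (f a.succ) t = 0 := hbelow _ (hfs a)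
    have hrows : (Fin.cons s f : Fin (k + 2) → Fin m) ∘ (1 : Fin (k + 2)).succAbove =
        Function.update f 0 s := by
      ext a
      refine Fin.cases ?_ (fun b => ?_) a
      · simp
      · simp
    have h0 : (Fin.cons s f : Fin (k + 2) → Fin m) ∘ Fin.succ = f := rfl
    have h1 : (Fin.cons t g : Fin (k + 2) → Fin n) ∘ Fin.succ = g := rfl
    simp [hz, hv, hrows, h0, h1] at hdet
    linarith

theorem det_submatrix_ratio_le {m n : ℕ} {A : Matrix (Fin m) (Fin n) ℝ}
    (hA : TotNonneg A) {s v : Fin m} {t : Fin n} (hsv : s ⋖ v)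
    (hzero : ∀ (i : Fin m) (j : Fin n), s ≤ i → j < t → A i j = 0)
    (hbelow : ∀ i : Fin m, v < i → A i t = 0) (hst : 0 ≤ A s t) {k : ℕ} {f : Fin k → Fin m}
    {g : Fin k → Fin n} (hf : StrictMono f) (hg : StrictMono g) (i : Fin k) (hv : f i = v)
    (hs : ∀ a, f a ≠ s) :
    A v t * (A.submatrix (Function.update f i s) g).det ≤ A s t * (A.submatrix f g).det := by
  induction k with
  | zero => exact i.elim0
  | succ k ih =>
    cases i using Fin.cases with
    | zero => exact det_submatrix_ratio_le_of_zero hA hsv.lt hzero hbelow hf hg hv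
    | succ i =>
      have hlt (a) (ha : a < i.succ) : f a < s :=
        (hsv.le_of_lt (hv ▸ hf ha)).lt_of_ne (hs a)
      have hgt (a) (ha : i.castSucc < a) : s < f a :=
        hsv.lt.trans_le (hv ▸ hf.monotone (Fin.castSucc_lt_iff_succ_le.mp ha))
      have hY : 0 ≤ (A.submatrix (Function.update f i.succ s) g).det :=
        hA _ _ _ (hf.update_of_lt hlt
          fun a ha => hgt a (i.castSucc_lt_succ.trans ha)) hg
      rcases hY.eq_or_lt with hY0 | hYpos
      · rw [← hY0, mul_zero]
        exact mul_nonneg hst (hA _ _ _ hf hg)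
      set h := f ∘ i.castSucc.succAbove with hh
      have hi : h i = v := by simp [hh, hv]
      have hmono : StrictMono h := hf.comp (Fin.strictMono_succAbove _)
      have hcomp : Function.update f i.succ s ∘ i.castSucc.succAbove = Function.update h i s := by
        rw [hh, ← Function.update_comp_eq_of_injective _ Fin.succAbove_right_injective,
          Fin.succAbove_castSucc_self]
      obtain ⟨j, hj⟩ : ∃ j : Fin (k + 1),
          (A.submatrix (Function.update h i s) (g ∘ j.succAbove)).det ≠ 0 := by
        by_contra! hall
        refine hYpos.ne' ?_
        rw [Matrix.det_succ_row _ i.castSucc]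
        refine Finset.sum_eq_zero fun j _ => ?_
        rw [Matrix.submatrix_submatrix, hcomp, hall, mul_zero]
      have hgj : StrictMono (g ∘ j.succAbove) := hg.comp (Fin.strictMono_succAbove _)
      have hhlt (a) (ha : a < i) : h a = f a.castSucc := by
        simp [hh, Fin.succAbove_of_castSucc_lt _ _ (Fin.castSucc_lt_castSucc_iff.mpr ha)]
      have hhgt (a) (ha : i < a) : h a = f a.succ := by
        simp [hh, Fin.succAbove_of_le_castSucc _ _ (Fin.castSucc_le_castSucc_iff.mpr ha.le)]
      have hY'pos : 0 < (A.submatrix (Function.update h i s) (g ∘ j.succAbove)).det :=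
        lt_of_le_of_ne' (hA _ _ _ (hmono.update_of_lt
          (fun a ha => hhlt a ha ▸ hlt _ (Fin.castSucc_lt_succ_iff.mpr ha.le))
          fun a ha => hhgt a ha ▸ hgt _ (Fin.castSucc_lt_succ_iff.mpr ha.le)) hgj) hj
      have hS : 0 ≤ (A.submatrix (Function.update f i.castSucc s) g).det :=
        hA _ _ _ (hf.update_of_lt
          (fun a ha => hlt a (ha.trans i.castSucc_lt_succ)) hgt) hg
      have hR : 0 ≤ (A.submatrix (Function.update h i (f i.castSucc)) (g ∘ j.succAbove)).det :=
        hA _ _ _ (hmono.update_of_lt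
          (fun a ha => hhlt a ha ▸ hf (Fin.castSucc_lt_castSucc_iff.mpr ha))
          fun a ha => hhgt a ha ▸ hf (Fin.castSucc_lt_succ_iff.mpr ha.le)) hgj
      have hpl := det_submatrix_mul_det_submatrix_update A f g i j s
      have hind := ih hmono hgj i hi (fun a => hs _)
      refine le_of_mul_le_mul_right ?_ hY'pos
      calc _ = (A.submatrix (Function.update f i.succ s) g).det *
              (A v t * (A.submatrix (Function.update h i s) (g ∘ j.succAbove)).det) := by ring
        _ ≤ (A.submatrix (Function.update f i.succ s) g).det *
              (A s t * (A.submatrix h (g ∘ j.succAbove)).det) :=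
            mul_le_mul_of_nonneg_left hind hY
        _ = A s t * ((A.submatrix (Function.update f i.succ s) g).det *
              (A.submatrix h (g ∘ j.succAbove)).det) := by ring
        _ ≤ A s t * ((A.submatrix f g).det *
              (A.submatrix (Function.update h i s) (g ∘ j.succAbove)).det) :=
            mul_le_mul_of_nonneg_left (hpl ▸ le_add_of_nonneg_right (mul_nonneg hS hR)) hst
        _ = _ := by ring

theorem TotNonneg.apply_nonneg {m n : ℕ} {A : Matrix (Fin m) (Fin n) ℝ} (hA : TotNonneg A)
    (i : Fin m) (j : Fin n) : 0 ≤ A i j := by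
  simpa using hA 1 (fun _ => i) (fun _ => j) (Subsingleton.strictMono _) (Subsingleton.strictMono _)

theorem neville_move_preserves_tnn {m n : ℕ}
    (A : Matrix (Fin m) (Fin n) ℝ) (hA : TotNonneg A)
    (s : Fin m) (hs : s.val + 1 < m) (t0 : Fin n)
    (hst : A s t0 ≠ 0)
    (hzero : ∀ (i : Fin m) (j : Fin n), s ≤ i → j < t0 → A i j = 0)
    (hst1 : A ⟨s.val + 1, hs⟩ t0 ≠ 0)
    (hbelow : ∀ i : Fin m, s.val + 1 < i.val → A i t0 = 0)
    (B : Matrix (Fin m) (Fin n) ℝ)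
    (hB : B = A.updateRow ⟨s.val + 1, hs⟩
      (fun j => A ⟨s.val + 1, hs⟩ j - (A ⟨s.val + 1, hs⟩ t0 / A s t0) * A s j)) :
    TotNonneg B := by
  subst hB
  set v : Fin m := ⟨s.val + 1, hs⟩ with hv
  have hsv : s ⋖ v := ⟨Fin.lt_def.mpr (by simp [hv]), fun c h₁ h₂ => by
    simp only [hv, Fin.lt_def] at h₁ h₂
    omega⟩
  have hpos : 0 < A s t0 := (hA.apply_nonneg s t0).lt_of_ne' hst
  intro k f g hf hg
  by_cases hvf : ∃ i, f i = v
  · obtain ⟨i, hi⟩ := hvf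
    have hsub : (A.updateRow v (fun j => A v j - A v t0 / A s t0 * A s j)).submatrix f g =
        (A.submatrix f g).updateRow i
          ((fun j => A v (g j)) + (-(A v t0 / A s t0)) • fun j => A s (g j)) := by
      ext a b
      rcases eq_or_ne a i with rfl | ha
      · simp [hi, sub_eq_add_neg]
      · have hav : f a ≠ v := fun h => ha (hf.injective (h.trans hi.symm))
        simp [Matrix.updateRow_ne ha, Matrix.updateRow_ne hav]
    rw [hsub, Matrix.det_updateRow_add, Matrix.det_updateRow_smul, ← submatrix_update_row,
      ← submatrix_update_row, ← hi, Function.update_eq_self, hi]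
    by_cases hsf : ∃ a, f a = s
    · obtain ⟨a, ha⟩ := hsf
      have hai : a ≠ i := by
        rintro rfl
        exact hsv.lt.ne (ha.symm.trans hi)
      have hz : (A.submatrix (Function.update f i s) g).det = 0 :=
        det_submatrix_eq_zero_of_not_injective A g hai (by simp [Function.update_of_ne hai, ha])
      rw [hz, mul_zero, add_zero]
      exact hA _ _ _ hf hg
    · push Not at hsf
      have hle := det_submatrix_ratio_le hA hsv hzero (fun i hi => hbelow i hi) hpos.le hf hg i hi
        hsf
      rw [neg_mul, ← sub_eq_add_neg, sub_nonneg, div_mul_eq_mul_div, div_le_iff₀ hpos]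
      linarith
  · push Not at hvf
    have hsub : (A.updateRow v (fun j => A v j - A v t0 / A s t0 * A s j)).submatrix f g =
        A.submatrix f g := by
      ext a b
      simp [Matrix.updateRow_ne (hvf a)]
    rw [hsub]
    exact hA _ _ _ hf hg
end

section
/- Every totally nonnegative m×n real matrix A of rank t admits a factorization A = LU where L is an m×t totally nonnegative matrix in strictly lower echelon form (class L_r^* for some r) and U is a t×n totally nonnegative matrix in strictly upper echelon form (class U_c for some c). -/
open Matrix

theorem det_submatrix_insertNth {R ι : Type*} [CommRing R] {k : ℕ}
    (M : Matrix (Fin (k + 1)) ι R) (i : Fin (k + 1)) (x : ι) (h : Fin k → ι) :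
    (M.submatrix id (Fin.insertNth i x h : Fin (k + 1) → ι)).det =
      (-1) ^ (i : ℕ) * (M.submatrix id (Fin.cons x h : Fin (k + 1) → ι)).det := by
  rw [← Fin.cons_comp_cycleRange x h i]
  have := det_permute' i.cycleRange (M.submatrix id (Fin.cons x h : Fin (k + 1) → ι))
  rw [submatrix_submatrix] at this
  simpa [Fin.sign_cycleRange] using this

theorem det_submatrix_snoc {R ι : Type*} [CommRing R] {k : ℕ}
    (M : Matrix (Fin (k + 1)) ι R) (x : ι) (h : Fin k → ι) :
    (M.submatrix id (Fin.snoc h x : Fin (k + 1) → ι)).det =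
      (-1) ^ k * (M.submatrix id (Fin.cons x h : Fin (k + 1) → ι)).det := by
  rw [← Fin.insertNth_last', det_submatrix_insertNth, Fin.val_last]

theorem insertNth_castSucc_snoc {ι : Type*} {k : ℕ} (i : Fin (k + 1)) (p c : ι) (h : Fin k → ι) :
    (Fin.insertNth i.castSucc p (Fin.snoc h c : Fin (k + 1) → ι) : Fin (k + 2) → ι) =
      Fin.snoc (Fin.insertNth i p h : Fin (k + 1) → ι) c := by
  rw [Fin.insertNth_eq_iff]
  refine ⟨by simp, ?_⟩
  funext j
  cases j using Fin.lastCases with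
  | last => simp [Fin.removeNth]
  | cast j => simp [Fin.removeNth, Fin.castSucc_succAbove_castSucc]

/-- Cramer's rule paired with the minor on the lower rows with columns `· , h`. -/
theorem det_mul_det_cons_eq {R ι : Type*} [CommRing R] {k : ℕ}
    (M : Matrix (Fin (k + 2)) ι R) (a c p : ι) (h : Fin k → ι) :
    (M.submatrix id (Fin.cons a (Fin.snoc h c : Fin (k + 1) → ι) : Fin (k + 2) → ι)).det *
      (M.submatrix Fin.succ (Fin.cons p h : Fin (k + 1) → ι)).det =
    (M.submatrix Fin.succ (Fin.cons a h : Fin (k + 1) → ι)).det *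
      (M.submatrix id (Fin.cons p (Fin.snoc h c : Fin (k + 1) → ι) : Fin (k + 2) → ι)).det +
    (M.submatrix Fin.succ (Fin.cons c h : Fin (k + 1) → ι)).det *
      (M.submatrix id (Fin.snoc (Fin.cons a h : Fin (k + 1) → ι) p : Fin (k + 2) → ι)).det := by
  set g : Fin (k + 2) → ι := Fin.cons a (Fin.snoc h c : Fin (k + 1) → ι) with hg
  set E : ι → R := fun q => (M.submatrix Fin.succ (Fin.cons q h : Fin (k + 1) → ι)).det with hE
  have hlin : ∀ q, E q = ∑ r : Fin (k + 1), M r.succ q *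
      ((-1) ^ (r : ℕ) * (M.submatrix (Fin.succ ∘ r.succAbove) h).det) := by
    intro q
    simp only [hE]
    rw [det_succ_column_zero]
    refine Finset.sum_congr rfl fun r _ => ?_
    rw [submatrix_submatrix]
    simp only [submatrix_apply, Fin.cons_zero]
    have : (Fin.cons q h : Fin (k + 1) → ι) ∘ Fin.succ = h := by ext; simp
    rw [this]
    ring
  have hcr : ∀ r, ∑ j, M r (g j) * (M.submatrix id (Function.update g j p)).det =
      (M.submatrix id g).det * M r p := by
    intro r
    have := congrFun (mulVec_cramer (M.submatrix id g) (fun r => M r p)) r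
    simp only [mulVec, dotProduct, cramer_apply, Pi.smul_apply, smul_eq_mul, submatrix_apply,
      id] at this
    rw [← this]
    refine Finset.sum_congr rfl fun j _ => ?_
    congr 2
    ext x y
    by_cases hy : y = j
    · subst hy; simp
    · simp [hy]
  have key : ∑ j, E (g j) * (M.submatrix id (Function.update g j p)).det =
      (M.submatrix id g).det * E p := by
    simp only [hlin, Finset.sum_mul, Finset.mul_sum]
    rw [Finset.sum_comm]
    refine Finset.sum_congr rfl fun r _ => ?_
    rw [← mul_assoc, ← hcr, Finset.sum_mul]
    exact Finset.sum_congr rfl fun j _ => by ring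
  have hzero : ∀ j : Fin k, E (h j) = 0 := fun j =>
    det_zero_of_column_eq (i := 0) (j := j.succ) (Fin.succ_ne_zero j).symm fun r => by simp
  have hgs : g = Fin.snoc (Fin.cons a h : Fin (k + 1) → ι) c := Fin.cons_snoc_eq_snoc_cons a h c
  have h0 : Function.update g 0 p = Fin.cons p (Fin.snoc h c : Fin (k + 1) → ι) := by
    rw [hg, Fin.update_cons_zero]
  have hl : Function.update g (Fin.last _) p = Fin.snoc (Fin.cons a h : Fin (k + 1) → ι) p := by
    rw [hgs, Fin.update_snoc_last]
  rw [← key, Fin.sum_univ_succ, Fin.sum_univ_castSucc]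
  have e1 : ∀ j : Fin k, g j.castSucc.succ = h j := fun j => by simp [hg]
  have e2 : g (Fin.last k).succ = c := by simp [hg]
  have e3 : g 0 = a := by simp [hg]
  simp only [e1, e2, e3, hzero, h0, zero_mul, Finset.sum_const_zero, zero_add]
  rw [Fin.succ_last, hl]

/-- The three-term Plücker relation, with all column tuples in sorted position. -/
theorem det_mul_det_insertNth_eq {R ι : Type*} [CommRing R] {k : ℕ}
    (M : Matrix (Fin (k + 2)) ι R) (a c p : ι) (h : Fin k → ι) (i : Fin (k + 1)) :
    (M.submatrix id (Fin.cons a (Fin.snoc h c : Fin (k + 1) → ι) : Fin (k + 2) → ι)).det *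
      (M.submatrix Fin.succ (Fin.insertNth i p h : Fin (k + 1) → ι)).det =
    (M.submatrix Fin.succ (Fin.cons a h : Fin (k + 1) → ι)).det *
      (M.submatrix id
        (Fin.snoc (Fin.insertNth i p h : Fin (k + 1) → ι) c : Fin (k + 2) → ι)).det +
    (M.submatrix Fin.succ (Fin.snoc h c : Fin (k + 1) → ι)).det *
      (M.submatrix id
        (Fin.cons a (Fin.insertNth i p h : Fin (k + 1) → ι) : Fin (k + 2) → ι)).det := by
  have key := det_mul_det_cons_eq M a c p h
  have e1 := det_submatrix_insertNth (M.submatrix Fin.succ id) i p h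
  have e2 := det_submatrix_snoc (M.submatrix Fin.succ id) c h
  have e3 := det_submatrix_insertNth M i.castSucc p (Fin.snoc h c : Fin (k + 1) → ι)
  have e4 := det_submatrix_insertNth M i.succ p (Fin.cons a h : Fin (k + 1) → ι)
  have e5 := det_submatrix_snoc M p (Fin.cons a h : Fin (k + 1) → ι)
  rw [submatrix_submatrix, submatrix_submatrix] at e1 e2
  simp only [Function.comp_id, Function.id_comp] at e1 e2
  rw [insertNth_castSucc_snoc] at e3
  rw [Fin.insertNth_succ_cons] at e4
  rw [e5] at key
  rw [e1, e2, e3, e4]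
  simp only [Fin.val_castSucc, Fin.val_succ, pow_succ] at *
  linear_combination (-1) ^ (i : ℕ) * key

/-- Fekete's criterion: if all minors on consecutive columns are positive, then all minors are. -/
theorem det_submatrix_pos_of_consecutive {m n : ℕ} (M : Matrix (Fin m) (Fin n) ℝ)
    (hM : ∀ (k a : ℕ) (f : Fin k → Fin m) (g : Fin k → Fin n), StrictMono f →
      (∀ i, (g i : ℕ) = a + i) → 0 < (M.submatrix f g).det) :
    ∀ (k : ℕ) (f : Fin k → Fin m) (g : Fin k → Fin n), StrictMono f → StrictMono g →
      0 < (M.submatrix f g).det := by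
  intro k
  induction k with
  | zero => intro f g _ _; simp
  | succ k ih =>
  rcases k with _ | k
  · intro f g hf _
    exact hM 1 (g 0) f g hf fun i => by simp [Subsingleton.elim i 0]
  intro f g hf hg
  induction hd : (g (Fin.last _) : ℕ) - g 0 using Nat.strong_induction_on generalizing g with
  | _ d ihd =>
  subst hd
  by_cases hcons : ∀ i : Fin (k + 1), (g i.succ : ℕ) = g i.castSucc + 1
  · refine hM _ (g 0) f g hf fun i => ?_
    induction i using Fin.induction with
    | zero => simp
    | succ i hi => rw [hcons, hi]; simp [add_assoc]
  push Not at hcons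
  obtain ⟨i, hi⟩ := hcons
  have hlt : (g i.castSucc : ℕ) < g i.succ := hg i.castSucc_lt_succ
  obtain ⟨p, hp1, hp2⟩ : ∃ p : Fin n, g i.castSucc < p ∧ p < g i.succ :=
    ⟨⟨g i.castSucc + 1, by omega⟩, Fin.lt_def.2 (by simp), Fin.lt_def.2 (by simp; omega)⟩
  set a := g 0 with ha
  set c := g (Fin.last _) with hc
  set h : Fin k → Fin n := fun j => g j.castSucc.succ with hh
  have hg1 : g = Fin.cons a (Fin.snoc h c : Fin (k + 1) → Fin n) := by
    funext j
    cases j using Fin.cases with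
    | zero => simp [ha]
    | succ j =>
      cases j using Fin.lastCases with
      | last => simp [hc]
      | cast j => simp [hh]
  set h' : Fin (k + 1) → Fin n := Fin.insertNth i p h with hh'
  have hap : a < p := (hg.monotone (Fin.zero_le _)).trans_lt hp1
  have hpc : p < c := hp2.trans_le (hg.monotone (Fin.le_last _))
  have hah : ∀ j, a < h j := fun j => hg (Fin.succ_pos _)
  have hhc : ∀ j, h j < c := fun j => hg (Fin.lt_def.2 (by simp))
  have hhm : StrictMono h := fun x y hxy => hg (by simpa using hxy)
  have hah' : ∀ j, a < h' j := fun j => by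
    cases j using Fin.succAboveCases i <;> simp [hh', hap, hah]
  have hhc' : ∀ j, h' j < c := fun j => by
    cases j using Fin.succAboveCases i <;> simp [hh', hpc, hhc]
  have hhm' : StrictMono h' := by
    refine (Fin.strictMono_insertNth_iff i p h).2 ⟨hhm, fun j hj => ?_, fun j hj => ?_⟩
    · exact (hg.monotone (Fin.le_def.2 (by simpa [Fin.lt_def] using hj))).trans_lt hp1
    · exact hp2.trans_le (hg.monotone (Fin.succ_le_succ_iff.2 hj))
  have snoc_mono : ∀ (l : ℕ) (u : Fin l → Fin n), StrictMono u → (∀ j, u j < c) →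
      StrictMono (Fin.snoc u c : Fin (l + 1) → Fin n) := by
    intro l u hu huc x y hxy
    cases y using Fin.lastCases with
    | last =>
      cases x using Fin.lastCases with
      | last => exact absurd hxy (lt_irrefl _)
      | cast x => simpa using huc x
    | cast y =>
      cases x using Fin.lastCases with
      | last => exact absurd hxy (not_lt.2 (Fin.le_last _))
      | cast x => simpa using hu (by simpa using hxy)
  have hfs : StrictMono (f ∘ Fin.succ) := hf.comp Fin.strictMono_succ
  have key := det_mul_det_insertNth_eq (M.submatrix f id) a c p h i
  simp only [submatrix_submatrix, Function.comp_id, Function.id_comp] at key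
  rw [← hg1, ← hh'] at key
  have p1 := ih (f ∘ Fin.succ) h' hfs hhm'
  have p2 := ih (f ∘ Fin.succ) (Fin.cons a h) hfs (Fin.strictMono_cons.2 ⟨hah, hhm⟩)
  have p3 := ih (f ∘ Fin.succ) (Fin.snoc h c) hfs (snoc_mono _ _ hhm hhc)
  have p4 := ihd _ (by
      have := hah' 0; have := hhc' 0
      simp only [Fin.snoc_last, ← Fin.castSucc_zero, Fin.snoc_castSucc]
      omega) (Fin.snoc h' c) (snoc_mono _ _ hhm' hhc') rfl
  have p5 := ihd _ (by
      have := hah' (Fin.last _); have := hhc' (Fin.last _)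
      simp only [← Fin.succ_last, Fin.cons_zero, Fin.cons_succ]
      omega) (Fin.cons a h') (Fin.strictMono_cons.2 ⟨hah', hhm'⟩) rfl
  refine pos_of_mul_pos_left ?_ p1.le
  rw [key]
  positivity

/-- The Cauchy–Binet formula. -/
theorem det_mul_eq_sum_strictMono {R : Type*} [CommRing R] {k m : ℕ}
    (P : Matrix (Fin k) (Fin m) R) (Q : Matrix (Fin m) (Fin k) R) :
    (P * Q).det = ∑ s : Fin k → Fin m with StrictMono s,
      (P.submatrix id s).det * (Q.submatrix s id).det := by
  have expand : (P * Q).det = ∑ p : Fin k → Fin m,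
      (P.submatrix id p).det * ∏ i, Q (p i) i := by
    simp only [det_apply', mul_apply, Finset.prod_univ_sum, Finset.mul_sum,
      Fintype.piFinset_univ, submatrix_apply, id, Finset.prod_mul_distrib, Finset.sum_mul]
    rw [Finset.sum_comm]
    simp only [mul_assoc]
  have hinj : ∑ p : Fin k → Fin m, (P.submatrix id p).det * ∏ i, Q (p i) i =
      ∑ p : Fin k → Fin m with Function.Injective p,
        (P.submatrix id p).det * ∏ i, Q (p i) i := by
    refine (Finset.sum_subset (Finset.filter_subset _ _) fun p _ hp => ?_).symm
    have hp' : ¬ Function.Injective p := by simpa using hp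
    simp only [Function.Injective, not_forall] at hp'
    obtain ⟨i, j, hij, hne⟩ := hp'
    rw [det_zero_of_column_eq hne fun r => by simp [hij], zero_mul]
  rw [expand, hinj]
  simp only [det_apply' (Q.submatrix _ _), Finset.mul_sum]
  rw [Finset.sum_sigma']
  symm
  refine Finset.sum_bij (fun x _ => x.1 ∘ x.2) ?_ ?_ ?_ ?_
  · rintro ⟨s, τ⟩ hs
    have hs' : StrictMono s := by simpa using hs
    simpa using hs'.injective
  · rintro ⟨s, τ⟩ hs ⟨s', τ'⟩ hs' h
    replace hs : StrictMono s := by simpa using hs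
    replace hs' : StrictMono s' := by simpa using hs'
    change s ∘ τ = s' ∘ τ' at h
    have e1 : (s ∘ τ) ∘ (τ⁻¹ : Equiv.Perm (Fin k)) = s := by ext; simp
    have e2 : (s ∘ τ) ∘ (τ'⁻¹ : Equiv.Perm (Fin k)) = s' := by rw [h]; ext; simp
    have hss : s = s' := by
      rw [← e1, ← e2]
      exact Tuple.unique_monotone (by rw [e1]; exact hs.monotone) (by rw [e2]; exact hs'.monotone)
    subst hss
    have : τ = τ' := Equiv.ext fun i => hs.injective (congrFun h i)
    rw [this]
  · intro p hp
    have hp' : Function.Injective p := by simpa using hp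
    refine ⟨⟨p ∘ Tuple.sort p, (Tuple.sort p)⁻¹⟩, ?_, ?_⟩
    · simpa using (Tuple.monotone_sort p).strictMono_of_injective
        (hp'.comp (Tuple.sort p).injective)
    · ext; simp
  · rintro ⟨s, τ⟩ _
    have := det_permute' τ (P.submatrix id s)
    rw [submatrix_submatrix] at this
    simp only [Function.comp_id] at this
    rw [this]
    simp only [submatrix_apply, id, Function.comp]
    ring

theorem strictMono_of_val_eq_add {k n a : ℕ} {g : Fin k → Fin n}
    (hg : ∀ i, (g i : ℕ) = a + i) : StrictMono g :=
  fun i j hij => Fin.lt_def.2 (by rw [hg, hg]; simpa using hij)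

theorem det_vandermonde_pos {k : ℕ} {x : Fin k → ℝ} (hx : StrictMono x) :
    0 < (vandermonde x).det := by
  rw [det_vandermonde]
  exact Finset.prod_pos fun i _ => Finset.prod_pos fun j hj =>
    sub_pos.2 (hx (Finset.mem_Ioi.1 hj))

/-- The Gaussian kernel `q ^ (i - j) ^ 2`, which is strictly totally positive for `0 < q < 1`
and specializes to the identity matrix at `q = 0`. -/
def gaussianKernel (m : ℕ) (q : ℝ) : Matrix (Fin m) (Fin m) ℝ :=
  of fun i j => q ^ (((i : ℤ) - j).natAbs ^ 2)

theorem gaussianKernel_zero (m : ℕ) : gaussianKernel m 0 = 1 := by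
  ext i j
  by_cases h : i = j
  · subst h; simp [gaussianKernel]
  · have : (i : ℤ) - j ≠ 0 := fun h' => h (Fin.ext (by omega))
    simp [gaussianKernel, h, this]

theorem gaussianKernel_apply_eq {m : ℕ} {q : ℝ} (hq : 0 < q) (i j : Fin m) :
    gaussianKernel m q i j =
      q ^ ((i : ℕ) ^ 2) * (q ^ ((j : ℕ) ^ 2) * (((q ^ 2)⁻¹) ^ (i : ℕ)) ^ (j : ℕ)) := by
  have h : ((i : ℤ) - j).natAbs ^ 2 + 2 * (i * j : ℕ) = (i : ℕ) ^ 2 + (j : ℕ) ^ 2 := by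
    zify
    rw [sq_abs]
    ring
  have h2 : (((q ^ 2)⁻¹) ^ (i : ℕ)) ^ (j : ℕ) * q ^ (2 * (i * j : ℕ)) = 1 := by
    rw [← pow_mul, pow_mul q 2, ← mul_pow, inv_mul_cancel₀ (by positivity), one_pow]
  refine mul_right_cancel₀ (pow_ne_zero (2 * (i * j : ℕ)) hq.ne') ?_
  rw [mul_assoc, mul_assoc, h2, mul_one, ← pow_add, ← h, pow_add]
  rfl

theorem gaussianKernel_det_pos {m : ℕ} {q : ℝ} (hq : 0 < q) (hq1 : q < 1) (k : ℕ)
    (f g : Fin k → Fin m) (hf : StrictMono f) (hg : StrictMono g) :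
    0 < ((gaussianKernel m q).submatrix f g).det := by
  refine det_submatrix_pos_of_consecutive _ (fun k a f g hf hg => ?_) k f g hf hg
  set y : ℝ := (q ^ 2)⁻¹ with hy
  have hy1 : 1 < y := (one_lt_inv₀ (by positivity)).2 (pow_lt_one₀ hq.le hq1 two_ne_zero)
  have hx : StrictMono fun i => y ^ (f i : ℕ) := fun i j hij => pow_lt_pow_right₀ hy1 (hf hij)
  have e : (gaussianKernel m q).submatrix f g = of fun i j => q ^ ((f i : ℕ) ^ 2) *
      (of fun i j => q ^ ((g j : ℕ) ^ 2) * (of fun i j => (y ^ (f i : ℕ)) ^ a *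
        vandermonde (fun i => y ^ (f i : ℕ)) i j) i j) i j := by
    ext i j
    simp only [submatrix_apply, gaussianKernel_apply_eq hq, of_apply, vandermonde_apply, hg,
      ← hy, pow_add]
  rw [e, det_mul_column, det_mul_row, det_mul_column]
  have := det_vandermonde_pos hx
  positivity

/-- Total nonnegativity from the nonnegativity of the minors on consecutive columns, provided
that for each set of consecutive columns one of these minors is nonzero. -/
theorem det_submatrix_nonneg_of_consecutive {m n : ℕ} (M : Matrix (Fin m) (Fin n) ℝ)
    (hM : ∀ (k a : ℕ) (f : Fin k → Fin m) (g : Fin k → Fin n), StrictMono f →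
      (∀ i, (g i : ℕ) = a + i) → 0 ≤ (M.submatrix f g).det)
    (hM' : ∀ (k : ℕ) (g : Fin k → Fin n), StrictMono g →
      ∃ f : Fin k → Fin m, StrictMono f ∧ (M.submatrix f g).det ≠ 0)
    (k : ℕ) (f : Fin k → Fin m) (g : Fin k → Fin n) (hf : StrictMono f) (hg : StrictMono g) :
    0 ≤ (M.submatrix f g).det := by
  have hpos : ∀ q : ℝ, 0 < q → q < 1 → 0 < ((gaussianKernel m q * M).submatrix f g).det := by
    intro q hq hq1
    refine det_submatrix_pos_of_consecutive _ (fun k a f g hf hg => ?_) k f g hf hg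
    rw [submatrix_mul _ _ f id g Function.bijective_id, det_mul_eq_sum_strictMono]
    simp only [submatrix_submatrix, Function.comp_id, Function.id_comp]
    obtain ⟨s, hs, hs0⟩ := hM' k g (strictMono_of_val_eq_add hg)
    refine Finset.sum_pos' (fun s' hs' => ?_) ⟨s, by simpa using hs, ?_⟩
    · have hs'' : StrictMono s' := by simpa using hs'
      exact mul_nonneg (gaussianKernel_det_pos hq hq1 _ _ _ hf hs'').le (hM _ a _ _ hs'' hg)
    · exact mul_pos (gaussianKernel_det_pos hq hq1 _ _ _ hf hs)
        ((hM _ a _ _ hs hg).lt_of_ne' hs0)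
  have hcont : Continuous fun q : ℝ => ((gaussianKernel m q * M).submatrix f g).det := by
    refine Continuous.matrix_det (Continuous.matrix_submatrix (Continuous.matrix_mul ?_
      continuous_const) f g)
    exact continuous_matrix fun i j => by simp only [gaussianKernel, of_apply]; fun_prop
  have hlim := (hcont.tendsto 0).mono_left (nhdsWithin_le_nhds (s := Set.Ioi 0))
  simp only [gaussianKernel_zero, Matrix.one_mul] at hlim
  refine ge_of_tendsto hlim ?_
  filter_upwards [Ioo_mem_nhdsGT (zero_lt_one (α := ℝ))] with q hq
  exact (hpos q hq.1 hq.2).le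

/-- Strictly lower echelon form with positive pivots. -/
def PosEchelon {m t : ℕ} (L : Matrix (Fin m) (Fin t) ℝ) (r : Fin t → Fin m) : Prop :=
  ∀ j, 0 < L (r j) j ∧ ∀ i, i < r j → L i j = 0

theorem PosEchelon.det_pos {m t k : ℕ} {L : Matrix (Fin m) (Fin t) ℝ} {r : Fin t → Fin m}
    (hL : PosEchelon L r) (hr : StrictMono r) {g : Fin k → Fin t} (hg : StrictMono g) :
    0 < (L.submatrix (r ∘ g) g).det := by
  rw [det_of_isLowerTriangular (L.submatrix (r ∘ g) g) fun i j hij => (hL (g j)).2 _ (hr (hg hij))]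
  exact Finset.prod_pos fun i _ => (hL (g i)).1

theorem PosEchelon.totNonneg {m t : ℕ} {L : Matrix (Fin m) (Fin t) ℝ} {r : Fin t → Fin m}
    (hL : PosEchelon L r) (hr : StrictMono r)
    (hlead : ∀ (k : ℕ) (f : Fin k → Fin m) (g : Fin k → Fin t), StrictMono f →
      (∀ i, (g i : ℕ) = i) → 0 ≤ (L.submatrix f g).det) :
    TotNonneg L := by
  intro k f g hf hg
  refine det_submatrix_nonneg_of_consecutive L (fun k a => ?_)
    (fun k g hg => ⟨r ∘ g, hr.comp hg, (hL.det_pos hr hg).ne'⟩) k f g hf hg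
  induction a generalizing k with
  | zero => exact fun f g hf hg => hlead k f g hf (by simpa using hg)
  | succ a ih =>
  intro f g hf hg
  rcases k with _ | k
  · simp
  have hg0 : (g 0 : ℕ) = a + 1 := by simpa using hg 0
  set b : Fin t := ⟨a, by omega⟩ with hb
  have hbg : ∀ j, b < g j := fun j => Fin.lt_def.2 (by rw [hg]; simp [hb]; omega)
  by_cases hfb : f 0 ≤ r b
  · exact (det_eq_zero_of_row_eq_zero 0 fun j =>
      (hL (g j)).2 _ (hfb.trans_lt (hr (hbg j)))).ge
  have hf' : StrictMono (Fin.cons (r b) f : Fin (k + 2) → Fin m) :=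
    Fin.strictMono_cons.2 ⟨fun j => (not_le.1 hfb).trans_le (hf.monotone (Fin.zero_le _)), hf⟩
  have key := ih (k + 2) (Fin.cons (r b) f) (Fin.cons b g) hf' fun i => by
    cases i using Fin.cases with
    | zero => simp [hb]
    | succ i => simp [hg]; ring
  rw [det_succ_row_zero, Fin.sum_univ_succ, Finset.sum_eq_zero fun j _ => ?_] at key
  · have e : (L.submatrix (Fin.cons (r b) f : Fin (k + 2) → Fin m)
        (Fin.cons b g : Fin (k + 2) → Fin t)).submatrix Fin.succ (Fin.succAbove 0) =
        L.submatrix f g := by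
      ext; simp
    rw [e] at key
    simp only [Fin.val_zero, pow_zero, one_mul, submatrix_apply, Fin.cons_zero, add_zero] at key
    exact nonneg_of_mul_nonneg_right key (hL b).1
  · simp [(hL (g j)).2 _ (hr (hbg j))]

theorem PosEchelon.leading_det_nonneg {m n t : ℕ} {L : Matrix (Fin m) (Fin t) ℝ}
    {U : Matrix (Fin t) (Fin n) ℝ} {c : Fin t → Fin n} (hU : PosEchelon Uᵀ c)
    (hc : StrictMono c) (hA : TotNonneg (L * U)) (k : ℕ) (f : Fin k → Fin m) (g : Fin k → Fin t)
    (hf : StrictMono f) (hg : ∀ i, (g i : ℕ) = i) :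
    0 ≤ (L.submatrix f g).det := by
  have hgm : StrictMono g := strictMono_of_val_eq_add (a := 0) (by simpa using hg)
  have e : (L * U).submatrix f (c ∘ g) = L.submatrix f g * U.submatrix g (c ∘ g) := by
    ext i j
    simp only [submatrix_apply, mul_apply]
    symm
    refine Fintype.sum_of_injective g hgm.injective _ _ (fun l hl => ?_) fun _ => rfl
    have hkl : k ≤ (l : ℕ) := by
      by_contra! h
      exact hl ⟨⟨l, h⟩, Fin.ext (hg _)⟩
    have hz : U l (c (g j)) = 0 :=
      (hU l).2 _ (hc (Fin.lt_def.2 (by rw [hg]; exact j.2.trans_le hkl)))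
    simp [hz]
  have h1 := hA k f (c ∘ g) hf (hc.comp hgm)
  have h2 := hU.det_pos hc hgm
  rw [← det_transpose, transpose_submatrix, transpose_transpose] at h2
  rw [e, det_mul] at h1
  exact nonneg_of_mul_nonneg_left h1 h2

theorem TotNonneg.transpose {m n : ℕ} {A : Matrix (Fin m) (Fin n) ℝ} (hA : TotNonneg A) :
    TotNonneg Aᵀ := fun k f g hf hg => by
  rw [← det_transpose, transpose_submatrix, transpose_transpose]
  exact hA k g f hg hf

/-- One step of Gaussian elimination with pivot `A p q`. -/
noncomputable def pivotStep {m n : ℕ} (A : Matrix (Fin m) (Fin n) ℝ) (p : Fin m) (q : Fin n) :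
    Matrix (Fin m) (Fin n) ℝ :=
  of fun i j => A i j - A i q / A p q * A p j

theorem det_submatrix_cons_eq_mul_pivotStep {m n k : ℕ} (A : Matrix (Fin m) (Fin n) ℝ)
    {p : Fin m} {q : Fin n} (hpq : A p q ≠ 0) (f : Fin k → Fin m) (g : Fin k → Fin n) :
    (A.submatrix (Fin.cons p f : Fin (k + 1) → Fin m) (Fin.cons q g : Fin (k + 1) → Fin n)).det =
      A p q * ((pivotStep A p q).submatrix f g).det := by
  set B := A.submatrix (Fin.cons p f : Fin (k + 1) → Fin m)
    (Fin.cons q g : Fin (k + 1) → Fin n) with hB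
  set d : Fin (k + 1) → ℝ := Fin.cons 0 fun i => A (f i) q / A p q with hd
  have hdet : B.det = (of fun i j => B i j - d i * B 0 j).det :=
    det_eq_of_forall_row_eq_smul_add_const d 0 rfl fun i j => by simp [hd]
  rw [hdet, det_succ_column_zero, Fin.sum_univ_succ, Finset.sum_eq_zero fun i _ => ?_]
  · have e : (of fun i j => B i j - d i * B 0 j).submatrix (Fin.succAbove 0) Fin.succ =
        (pivotStep A p q).submatrix f g := by
      ext; simp [hB, hd, pivotStep]
    rw [e]
    simp [hB, hd]
  · simp [hB, hd, hpq]

theorem totNonneg_pivotStep {m n : ℕ} {A : Matrix (Fin m) (Fin n) ℝ} (hA : TotNonneg A)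
    {p : Fin m} {q : Fin n} (hpq : A p q ≠ 0) (hp : ∀ i < p, ∀ j, A i j = 0)
    (hq : ∀ j < q, ∀ i, A i j = 0) : TotNonneg (pivotStep A p q) := by
  intro k f g hf hg
  by_cases hfp : ∀ i, p < f i
  · by_cases hgq : ∀ j, q < g j
    · have := hA _ _ _ (Fin.strictMono_cons.2 ⟨hfp, hf⟩) (Fin.strictMono_cons.2 ⟨hgq, hg⟩)
      rw [det_submatrix_cons_eq_mul_pivotStep A hpq] at this
      exact nonneg_of_mul_nonneg_right this ((hA.apply_nonneg p q).lt_of_ne' hpq)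
    · push Not at hgq
      obtain ⟨j, hj⟩ := hgq
      refine (det_eq_zero_of_column_eq_zero j fun i => ?_).ge
      rcases hj.lt_or_eq with h | h
      · simp [pivotStep, hq _ h]
      · simp [pivotStep, h, hpq]
  · push Not at hfp
    obtain ⟨i, hi⟩ := hfp
    refine (det_eq_zero_of_row_eq_zero i fun j => ?_).ge
    rcases hi.lt_or_eq with h | h
    · simp [pivotStep, hp _ h]
    · simp [pivotStep, h, hpq]

theorem TotNonneg.exists_pivot {m n : ℕ} {A : Matrix (Fin m) (Fin n) ℝ} (hA : TotNonneg A)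
    (h0 : A ≠ 0) : ∃ p q, A p q ≠ 0 ∧ (∀ i < p, ∀ j, A i j = 0) ∧ ∀ j < q, ∀ i, A i j = 0 := by
  obtain ⟨i₀, j₀, h⟩ : ∃ i j, A i j ≠ 0 := by
    by_contra! h
    exact h0 (by ext; simp [h])
  obtain ⟨p, ⟨j, hj⟩, hp⟩ := WellFounded.has_min (wellFounded_lt (α := Fin m))
    {i | ∃ j, A i j ≠ 0} ⟨i₀, j₀, h⟩
  obtain ⟨q, ⟨i, hi⟩, hq⟩ := WellFounded.has_min (wellFounded_lt (α := Fin n))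
    {j | ∃ i, A i j ≠ 0} ⟨j₀, i₀, h⟩
  refine ⟨p, q, fun hpq => ?_, fun i hip j => ?_, fun j hjq i => ?_⟩
  · have hpi : p < i := (not_lt.1 (hp i ⟨q, hi⟩)).lt_of_ne (by rintro rfl; exact hi hpq)
    have hqj : q < j := (not_lt.1 (hq j ⟨p, hj⟩)).lt_of_ne (by rintro rfl; exact hj hpq)
    have := hA 2 ![p, i] ![q, j] (by simpa using hpi) (by simpa using hqj)
    rw [det_fin_two] at this
    simp only [submatrix_apply, cons_val_zero, cons_val_one, hpq, zero_mul, zero_sub] at this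
    have := mul_pos ((hA.apply_nonneg p j).lt_of_ne' hj) ((hA.apply_nonneg i q).lt_of_ne' hi)
    linarith
  · by_contra h
    exact hp i ⟨j, h⟩ hip
  · by_contra h
    exact hq j ⟨i, h⟩ hjq

theorem TotNonneg.exists_echelon_factorization {m n : ℕ} (A : Matrix (Fin m) (Fin n) ℝ)
    (hA : TotNonneg A) :
    ∃ (t : ℕ) (r : Fin t → Fin m) (c : Fin t → Fin n) (L : Matrix (Fin m) (Fin t) ℝ)
      (U : Matrix (Fin t) (Fin n) ℝ), StrictMono r ∧ StrictMono c ∧ InLstar L r ∧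
      PosEchelon Uᵀ c ∧ A = L * U ∧ (∀ k, ∃ j, A (r k) j ≠ 0) ∧ ∀ k, ∃ i, A i (c k) ≠ 0 := by
  classical
  induction hN : (Finset.univ.filter fun i => ∃ j, A i j ≠ 0).card using
    Nat.strong_induction_on generalizing A with
  | _ N ih =>
  by_cases h0 : A = 0
  · exact ⟨0, Fin.elim0, Fin.elim0, 0, 0, Subsingleton.strictMono _, Subsingleton.strictMono _,
      fun j => j.elim0, fun j => j.elim0, by simp [h0], fun j => j.elim0, fun j => j.elim0⟩
  obtain ⟨p, q, hpq, hp, hq⟩ := hA.exists_pivot h0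
  set A' := pivotStep A p q with hA'
  have hrow : ∀ i ≤ p, ∀ j, A' i j = 0 := fun i hi j => by
    rcases hi.lt_or_eq with h | h
    · simp [hA', pivotStep, hp _ h]
    · simp [hA', pivotStep, h, hpq]
  have hcol : ∀ j ≤ q, ∀ i, A' i j = 0 := fun j hj i => by
    rcases hj.lt_or_eq with h | h
    · simp [hA', pivotStep, hq _ h]
    · simp [hA', pivotStep, h, hpq]
  have hrowz : ∀ i, (∃ j, A' i j ≠ 0) → ∃ j, A i j ≠ 0 := fun i => by
    contrapose!
    intro h j
    simp [hA', pivotStep, h]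
  have hcolz : ∀ j, (∃ i, A' i j ≠ 0) → ∃ i, A i j ≠ 0 := fun j => by
    contrapose!
    intro h i
    simp [hA', pivotStep, h]
  have hcard : (Finset.univ.filter fun i => ∃ j, A' i j ≠ 0).card < N := by
    rw [← hN]
    refine Finset.card_lt_card (Finset.ssubset_iff_of_subset ?_ |>.2 ⟨p, ?_, ?_⟩)
    · exact Finset.monotone_filter_right _ fun i _ => hrowz i
    · simpa using ⟨q, hpq⟩
    · simp [hrow p le_rfl]
  obtain ⟨t, r, c, L, U, hr, hc, hL, hU, hLU, hrz, hcz⟩ :=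
    ih _ hcard A' (totNonneg_pivotStep hA hpq hp hq) rfl
  refine ⟨t + 1, Fin.cons p r, Fin.cons q c, of fun i => Fin.cons (A i q / A p q) (L i),
    of fun k j => (Fin.cons (A p j) fun l => U l j : Fin (t + 1) → ℝ) k,
    Fin.strictMono_cons.2 ⟨fun k => ?_, hr⟩, Fin.strictMono_cons.2 ⟨fun k => ?_, hc⟩,
    fun k => ?_, fun k => ?_, ?_, fun k => ?_, fun k => ?_⟩
  · obtain ⟨j, hj⟩ := hrz k
    exact not_le.1 fun h => hj (hrow _ h j)
  · obtain ⟨i, hi⟩ := hcz k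
    exact not_le.1 fun h => hi (hcol _ h i)
  · cases k using Fin.cases with
    | zero => exact ⟨by simp [hpq], fun i hi => by simp [hp i hi]⟩
    | succ k => exact ⟨by simpa using (hL k).1, fun i hi => by simpa using (hL k).2 i hi⟩
  · cases k using Fin.cases with
    | zero =>
      exact ⟨by simpa using (hA.apply_nonneg p q).lt_of_ne' hpq, fun j hj => by simp [hq j hj]⟩
    | succ k => exact ⟨by simpa using (hU k).1, fun i hi => by simpa using (hU k).2 i hi⟩
  · ext i j
    have := congrFun (congrFun hLU i) j
    simp only [mul_apply, hA', pivotStep, of_apply] at this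
    simp [mul_apply, Fin.sum_univ_succ, ← this]
  · cases k using Fin.cases with
    | zero => exact ⟨q, by simpa using hpq⟩
    | succ k => simpa using hrowz _ (hrz k)
  · cases k using Fin.cases with
    | zero => exact ⟨p, by simpa using hpq⟩
    | succ k => simpa using hcolz _ (hcz k)

theorem PosEchelon.rank_eq {m t : ℕ} {L : Matrix (Fin m) (Fin t) ℝ} {r : Fin t → Fin m}
    (hL : PosEchelon L r) (hr : StrictMono r) : L.rank = t := by
  refine le_antisymm (by simpa using L.rank_le_card_width) ?_
  have h := rank_of_det_ne_zero (hL.det_pos hr (g := id) strictMono_id).ne'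
  have h' := L.rank_submatrix_le (r ∘ id) id
  rwa [h, Fintype.card_fin] at h'

theorem PosEchelon.rank_mul_eq {m n t : ℕ} {L : Matrix (Fin m) (Fin t) ℝ}
    {U : Matrix (Fin t) (Fin n) ℝ} {r : Fin t → Fin m} {c : Fin t → Fin n}
    (hL : PosEchelon L r) (hr : StrictMono r) (hU : PosEchelon Uᵀ c) (hc : StrictMono c) :
    (L * U).rank = t := by
  refine le_antisymm ((rank_mul_le_left L U).trans_eq (hL.rank_eq hr)) ?_
  have h := rank_mul_eq_right_of_det_ne_zero (L.submatrix r id) U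
    (hL.det_pos hr (g := id) strictMono_id).ne'
  have h' := (L * U).rank_submatrix_le r id
  rw [submatrix_mul L U r id id Function.bijective_id, submatrix_id_id, h] at h'
  rwa [← rank_transpose, hU.rank_eq hc] at h'

theorem tnn_LU_factorization {m n : ℕ} (A : Matrix (Fin m) (Fin n) ℝ)
    (hA : TotNonneg A) :
    ∃ (r : Fin A.rank → Fin m) (c : Fin A.rank → Fin n)
      (L : Matrix (Fin m) (Fin A.rank) ℝ) (U : Matrix (Fin A.rank) (Fin n) ℝ),
      StrictMono r ∧ StrictMono c ∧ InLstar L r ∧ InU U c ∧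
      TotNonneg L ∧ TotNonneg U ∧ A = L * U := by
  obtain ⟨t, r, c, L, U, hr, hc, hL, hU, hLU, -, -⟩ := hA.exists_echelon_factorization
  have hLp : PosEchelon L r := fun j => ⟨by rw [(hL j).1]; exact one_pos, (hL j).2⟩
  have hrank : A.rank = t := by rw [hLU, hLp.rank_mul_eq hr hU hc]
  subst hrank
  refine ⟨r, c, L, U, hr, hc, hL, fun i => ⟨(hU i).1.ne', (hU i).2⟩, ?_, ?_, hLU⟩
  · exact hLp.totNonneg hr (hU.leading_det_nonneg hc (hLU ▸ hA))
  · have hA' : TotNonneg (Uᵀ * Lᵀ) := by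
      rw [← transpose_mul, ← hLU]
      exact hA.transpose
    have hLt : PosEchelon Lᵀᵀ r := hLp
    exact (hU.totNonneg hc (hLt.leading_det_nonneg hr hA')).transpose
end
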